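/- (Property (M4): trajectory bounds.) There exists a constant C > 0 such that for every m = (m_0,m_1,m_2) ∈ ℝ × ℝ^d × ℝ^d with m_0 ≠ 0, every (t,x,v) ∈ ℝ^{1+2d} and every r > 0: (i) |(d/dr) γ^m_v(r;(t,x,v))| ≤ C (|m_1|/|m_0| + |m_2|); (ii) |γ^m_v(r;(t,x,v)) − v| ≤ C (|m_1|/|m_0| + |m_2|) r; (iii) |γ^m_x(r;(t,x,v)) − x − m_0 v r^2| ≤ C (|m_1| + |m_0||m_2|) r^3. Here |·| denotes the Euclidean norm on ℝ^d. -/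

import Mathlib

open MeasureTheory Real ENNReal
open scoped RealInnerProductSpace

noncomputable section

/-- Euclidean space `ℝ^d`. -/
abbrev V (d : ℕ) : Type := EuclideanSpace ℝ (Fin d)

/-- The kinetic phase space `ℝ^{1+2d}`, with points `(t, x, v)`. -/
abbrev Pt (d : ℕ) : Type := ℝ × V d × V d

/-- Kinetic composition `(t,x,v) ∘ (s,y,w) = (t+s, x+y+s v, v+w)`. -/
def kmul {d : ℕ} (a b : Pt d) : Pt d :=
  (a.1 + b.1, a.2.1 + b.2.1 + b.1 • a.2.2, a.2.2 + b.2.2)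

/-- Kinetic inverse `(t,x,v)⁻¹ = (−t, −x+t v, −v)`. -/
def kinv {d : ℕ} (a : Pt d) : Pt d :=
  (-a.1, -a.2.1 + a.1 • a.2.2, -a.2.2)

/-- `g₁(r) = r³ sin(log r)`, extended by `0` at `r = 0`. -/
def g1 (r : ℝ) : ℝ := r ^ 3 * Real.sin (Real.log r)

/-- `g₂(r) = r³ cos(log r)`, extended by `0` at `r = 0`. -/
def g2 (r : ℝ) : ℝ := r ^ 3 * Real.cos (Real.log r)

/-- `ġ₁(r)/(2r) = (r/2)(3 sin(log r) + cos(log r))`, extended by `0` at `r = 0`. -/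
def h1 (r : ℝ) : ℝ := r / 2 * (3 * Real.sin (Real.log r) + Real.cos (Real.log r))

/-- `ġ₂(r)/(2r) = (r/2)(3 cos(log r) − sin(log r))`, extended by `0` at `r = 0`. -/
def h2 (r : ℝ) : ℝ := r / 2 * (3 * Real.cos (Real.log r) - Real.sin (Real.log r))

/-- The matrix `W(r)`, recorded through its scalar block entries as a `2×2` real matrix;
the full `2d×2d` matrix is the blockwise tensor with `Id_d`. -/
def Wm (r : ℝ) : Matrix (Fin 2) (Fin 2) ℝ := !![g1 r, g2 r; h1 r, h2 r]

/-- The matrix `D_δ` (scalar block entries). -/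
def Dm (δ : ℝ) : Matrix (Fin 2) (Fin 2) ℝ := !![δ, 0; 0, 1]

/-- The matrix `E_δ(r)` (scalar block entries). -/
def Em (δ r : ℝ) : Matrix (Fin 2) (Fin 2) ℝ := !![1, δ * r ^ 2; 0, 1]

/-- `A_{m₀}(r) = D_{m₀} W(r) D_{m₀}⁻¹` (scalar block entries). -/
def Am (m0 r : ℝ) : Matrix (Fin 2) (Fin 2) ℝ := Dm m0 * Wm r * (Dm m0)⁻¹

/-- The action on `ℝ^d × ℝ^d` of a `2×2` block matrix whose blocks are the scalar
multiples of `Id_d` given by the entries of `M`. -/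
def act {d : ℕ} (M : Matrix (Fin 2) (Fin 2) ℝ) (p : V d × V d) : V d × V d :=
  (M 0 0 • p.1 + M 0 1 • p.2, M 1 0 • p.1 + M 1 1 • p.2)

/-- The kinetic trajectory `γ^m(r; (t,x,v))`. -/
def gammaK {d : ℕ} (m : Pt d) (z : Pt d) (r : ℝ) : Pt d :=
  (z.1 + m.1 * r ^ 2,
   (act (Em m.1 r) (z.2.1, z.2.2) + act (Am m.1 r) (m.2.1, m.2.2)).1,
   (act (Em m.1 r) (z.2.1, z.2.2) + act (Am m.1 r) (m.2.1, m.2.2)).2)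

/-- Build a vector of `ℝ^d` from components. -/
def mkV {d : ℕ} (f : Fin d → ℝ) : V d := (EuclideanSpace.equiv (Fin d) ℝ).symm f

/-- The argument `(s/r², A_{s/r²}(r)⁻¹ (y,w)ᵀ)` fed into `ψ`. -/
def psiArg {d : ℕ} (r : ℝ) (m : Pt d) : Pt d :=
  (m.1 / r ^ 2,
   (act ((Am (m.1 / r ^ 2) r)⁻¹) (m.2.1, m.2.2)).1,
   (act ((Am (m.1 / r ^ 2) r)⁻¹) (m.2.1, m.2.2)).2)

/-- The mollification kernel `K_r(s,y,w) = 2^d r^{−Q} ψ(s/r², A_{s/r²}(r)⁻¹(y,w)ᵀ)`,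
with `Q = 4d+2`. -/
def Kker {d : ℕ} (ψ : Pt d → ℝ) (r : ℝ) (m : Pt d) : ℝ :=
  2 ^ d * r ^ (-(4 * (d : ℤ) + 2)) * ψ (psiArg r m)

/-- The kernel `K̃_r(s,y,w) = −2^{d+1} s r^{−Q−1} ψ(s/r², A_{s/r²}(r)⁻¹(y,w)ᵀ)`. -/
def Ktil {d : ℕ} (ψ : Pt d → ℝ) (r : ℝ) (m : Pt d) : ℝ :=
  -(2 ^ (d + 1)) * m.1 * r ^ (-(4 * (d : ℤ) + 2) - 1) * ψ (psiArg r m)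

/-- First coefficient of the forcing matrix `F_{m₀}(r)`: `(1/m₀) ∂_r (ġ₁(r)/(2r))`. -/
def F1 (m0 r : ℝ) : ℝ := (1 / m0) * deriv h1 r

/-- Second coefficient of the forcing matrix `F_{m₀}(r)`: `∂_r (ġ₂(r)/(2r))`. -/
def F2 (r : ℝ) : ℝ := deriv h2 r

/-- The kernel `K⃗_r(s,y,w) = −2^d r^{−Q} ψ(⋯) F_{s/r²}(r) A_{s/r²}(r)⁻¹ (y,w)ᵀ ∈ ℝ^d`. -/
def Kvec {d : ℕ} (ψ : Pt d → ℝ) (r : ℝ) (m : Pt d) : V d :=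
  (-(2 ^ d) * r ^ (-(4 * (d : ℤ) + 2)) * ψ (psiArg r m)) •
    (F1 (m.1 / r ^ 2) r • (act ((Am (m.1 / r ^ 2) r)⁻¹) (m.2.1, m.2.2)).1 +
      F2 r • (act ((Am (m.1 / r ^ 2) r)⁻¹) (m.2.1, m.2.2)).2)

/-- The gradient of `u : ℝ^{1+2d} → ℝ` in the `x`-variables (the `m₁` block). -/
def gradX {d : ℕ} (u : Pt d → ℝ) (z : Pt d) : V d :=
  mkV fun i => fderiv ℝ u z (0, EuclideanSpace.single i 1, 0)

/-- The gradient of `u : ℝ^{1+2d} → ℝ` in the `v`-variables (the `m₂` block). -/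
def gradV {d : ℕ} (u : Pt d → ℝ) (z : Pt d) : V d :=
  mkV fun i => fderiv ℝ u z (0, 0, EuclideanSpace.single i 1)

/-- The kernel `K⃗^π_r(s,y,w)
  = 2^{d+1} s r^{−Q−1} [(A_{s/r²}(r)⁻¹)_{·;2}]ᵀ [∇_{(m₁,m₂)}ψ](⋯) ∈ ℝ^d`. -/
def Kpi {d : ℕ} (ψ : Pt d → ℝ) (r : ℝ) (m : Pt d) : V d :=
  (2 ^ (d + 1) * m.1 * r ^ (-(4 * (d : ℤ) + 2) - 1)) •
    ((Am (m.1 / r ^ 2) r)⁻¹ 0 1 • gradX ψ (psiArg r m) +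
      (Am (m.1 / r ^ 2) r)⁻¹ 1 1 • gradV ψ (psiArg r m))

/-- Kinetic convolution operator for scalar kernels:
`[T_J f](z) = ∫ J(z⁻¹ ∘ m) f(m) dm`. -/
def Tsc {d : ℕ} (J : Pt d → ℝ) (f : Pt d → ℝ) (z : Pt d) : ℝ :=
  ∫ m, J (kmul (kinv z) m) * f m

/-- Kinetic convolution operator for `ℝ^d`-valued kernels:
`[T_J f](z) = ∫ J(z⁻¹ ∘ m) · f(m) dm`. -/
def Tvec {d : ℕ} (J : Pt d → V d) (f : Pt d → V d) (z : Pt d) : ℝ :=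
  ∫ m, ⟪J (kmul (kinv z) m), f m⟫

/-- The support and nonnegativity conditions on the bump function `ψ`:
smooth, nonnegative, unit mass, supported in `(−2,−1) × B₁(0) × B₁(0)`. -/
structure IsKineticBump {d : ℕ} (ψ : Pt d → ℝ) : Prop where
  smooth : ContDiff ℝ (⊤ : ℕ∞) ψ
  nonneg : ∀ m, 0 ≤ ψ m
  mass : ∫ m, ψ m = 1
  supp : ∀ m : Pt d, ψ m ≠ 0 →
    m.1 ∈ Set.Ioo (-2 : ℝ) (-1) ∧ ‖m.2.1‖ < 1 ∧ ‖m.2.2‖ < 1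

/-- The kinetic box `B_r^kin = {(s,y,w) : |s| < r², |y| < r³, |w| < r}`. -/
def kinBox (d : ℕ) (r : ℝ) : Set (Pt d) :=
  {m | |m.1| < r ^ 2 ∧ ‖m.2.1‖ < r ^ 3 ∧ ‖m.2.2‖ < r}

theorem Am_eq {m₀ : ℝ} (hm : m₀ ≠ 0) (r : ℝ) :
    Am m₀ r = !![g1 r, m₀ * g2 r; h1 r / m₀, h2 r] := by
  have hinv : (Dm m₀)⁻¹ = !![m₀⁻¹, 0; 0, 1] := by
    refine Matrix.inv_eq_right_inv ?_
    simp [Dm, Matrix.one_fin_two, hm]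
  rw [Am, hinv]
  ext i j
  fin_cases i <;> fin_cases j <;> simp [Dm, Wm] <;> field_simp

theorem gammaK_x_eq {d : ℕ} (m z : Pt d) (hm : m.1 ≠ 0) (r : ℝ) :
    (gammaK m z r).2.1 =
      z.2.1 + (m.1 * r ^ 2) • z.2.2 + (g1 r • m.2.1 + (m.1 * g2 r) • m.2.2) := by
  simp [gammaK, act, Am_eq hm, Em]

theorem gammaK_v_eq {d : ℕ} (m z : Pt d) (hm : m.1 ≠ 0) (r : ℝ) :
    (gammaK m z r).2.2 = z.2.2 + ((h1 r / m.1) • m.2.1 + h2 r • m.2.2) := by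
  simp [gammaK, act, Am_eq hm, Em]

theorem hasDerivAt_h1 {r : ℝ} (hr : r ≠ 0) :
    HasDerivAt h1 (sin (log r) + 2 * cos (log r)) r := by
  have hlog := hasDerivAt_log hr
  have h := ((hasDerivAt_id r).div_const 2).mul ((hlog.sin.const_mul 3).add hlog.cos)
  refine h.congr_deriv ?_
  simp only [id, Pi.add_apply]
  field_simp
  ring

theorem hasDerivAt_h2 {r : ℝ} (hr : r ≠ 0) :
    HasDerivAt h2 (cos (log r) - 2 * sin (log r)) r := by
  have hlog := hasDerivAt_log hr
  have h := ((hasDerivAt_id r).div_const 2).mul ((hlog.cos.const_mul 3).sub hlog.sin)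
  refine h.congr_deriv ?_
  simp only [id, Pi.sub_apply]
  field_simp
  ring

theorem abs_mul_sin_add_mul_cos_le (a b θ : ℝ) : |a * sin θ + b * cos θ| ≤ |a| + |b| := by
  refine (abs_add_le _ _).trans (add_le_add ?_ ?_) <;> rw [abs_mul]
  · exact mul_le_of_le_one_right (abs_nonneg a) (abs_sin_le_one θ)
  · exact mul_le_of_le_one_right (abs_nonneg b) (abs_cos_le_one θ)

theorem abs_g1_le {r : ℝ} (hr : 0 ≤ r) : |g1 r| ≤ r ^ 3 := by
  rw [g1, abs_mul, abs_of_nonneg (pow_nonneg hr 3)]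
  exact mul_le_of_le_one_right (pow_nonneg hr 3) (abs_sin_le_one _)

theorem abs_g2_le {r : ℝ} (hr : 0 ≤ r) : |g2 r| ≤ r ^ 3 := by
  rw [g2, abs_mul, abs_of_nonneg (pow_nonneg hr 3)]
  exact mul_le_of_le_one_right (pow_nonneg hr 3) (abs_cos_le_one _)

theorem abs_h1_le {r : ℝ} (hr : 0 ≤ r) : |h1 r| ≤ 2 * r := by
  have h := abs_mul_sin_add_mul_cos_le 3 1 (log r)
  norm_num at h
  rw [h1, abs_mul, abs_of_nonneg (by positivity)]
  nlinarith

theorem abs_h2_le {r : ℝ} (hr : 0 ≤ r) : |h2 r| ≤ 2 * r := by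
  have h := abs_mul_sin_add_mul_cos_le (-1) 3 (log r)
  norm_num at h
  rw [neg_add_eq_sub] at h
  rw [h2, abs_mul, abs_of_nonneg (by positivity)]
  nlinarith

theorem norm_smul_add_smul_le {E : Type*} [SeminormedAddCommGroup E] [NormedSpace ℝ E]
    {a b α β : ℝ} (ha : |a| ≤ α) (hb : |b| ≤ β) (x y : E) :
    ‖a • x + b • y‖ ≤ α * ‖x‖ + β * ‖y‖ := by
  refine (norm_add_le _ _).trans ?_
  rw [norm_smul, norm_smul, norm_eq_abs, norm_eq_abs]
  gcongr

/-- **(M4): trajectory bounds.** There is `C > 0` such that for every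
`m = (m₀,m₁,m₂)` with `m₀ ≠ 0`, every `(t,x,v)` and every `r > 0`:
(i) the velocity component of the trajectory is differentiable with
`|γ̇^m_v(r)| ≤ C (|m₁|/|m₀| + |m₂|)`;
(ii) `|γ^m_v(r) − v| ≤ C (|m₁|/|m₀| + |m₂|) r`;
(iii) `|γ^m_x(r) − x − m₀ v r²| ≤ C (|m₁| + |m₀||m₂|) r³`. -/
theorem statement3 (d : ℕ) (hd : 1 ≤ d) :
    ∃ C : ℝ, 0 < C ∧ ∀ m : Pt d, m.1 ≠ 0 → ∀ z : Pt d, ∀ r : ℝ, 0 < r →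
      (∃ e : V d, HasDerivAt (fun ρ => (gammaK m z ρ).2.2) e r ∧
          ‖e‖ ≤ C * (‖m.2.1‖ / |m.1| + ‖m.2.2‖)) ∧
      ‖(gammaK m z r).2.2 - z.2.2‖ ≤ C * (‖m.2.1‖ / |m.1| + ‖m.2.2‖) * r ∧
      ‖(gammaK m z r).2.1 - z.2.1 - (m.1 * r ^ 2) • z.2.2‖ ≤
        C * (‖m.2.1‖ + |m.1| * ‖m.2.2‖) * r ^ 3 := by
  refine ⟨3, by norm_num, fun m hm z r hr => ⟨?_, ?_, ?_⟩⟩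
  · refine ⟨((sin (log r) + 2 * cos (log r)) / m.1) • m.2.1 +
      (cos (log r) - 2 * sin (log r)) • m.2.2, ?_, ?_⟩
    · simp only [gammaK_v_eq m z hm]
      exact ((((hasDerivAt_h1 hr.ne').div_const m.1).smul_const m.2.1).add
        ((hasDerivAt_h2 hr.ne').smul_const m.2.2)).const_add z.2.2
    · have h₁ : |(sin (log r) + 2 * cos (log r)) / m.1| ≤ 3 / |m.1| := by
        have h := abs_mul_sin_add_mul_cos_le 1 2 (log r)
        norm_num at h
        rw [abs_div]
        gcongr
      have h₂ : |cos (log r) - 2 * sin (log r)| ≤ 3 := by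
        have h := abs_mul_sin_add_mul_cos_le (-2) 1 (log r)
        norm_num at h
        rwa [neg_add_eq_sub] at h
      exact (norm_smul_add_smul_le h₁ h₂ m.2.1 m.2.2).trans_eq (by ring)
  · have h₁ : |h1 r / m.1| ≤ 3 * r / |m.1| := by
      rw [abs_div]
      gcongr
      linarith [abs_h1_le hr.le]
    have h₂ : |h2 r| ≤ 3 * r := by linarith [abs_h2_le hr.le]
    rw [gammaK_v_eq m z hm, add_sub_cancel_left]
    exact (norm_smul_add_smul_le h₁ h₂ m.2.1 m.2.2).trans_eq (by ring)
  · have hr3 : 0 < r ^ 3 := pow_pos hr 3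
    have h₁ : |g1 r| ≤ 3 * r ^ 3 := by linarith [abs_g1_le hr.le]
    have h₂ : |m.1 * g2 r| ≤ |m.1| * (3 * r ^ 3) := by
      rw [abs_mul]
      gcongr
      linarith [abs_g2_le hr.le]
    rw [gammaK_x_eq m z hm, sub_sub, add_sub_cancel_left]
    exact (norm_smul_add_smul_le h₁ h₂ m.2.1 m.2.2).trans_eq (by ring)
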